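/- (Claim 3.4) Let ρ ∈ (−1,1) and let M_{ρσ}(x,y) be the 2×2 symmetric matrix with diagonal entries ∂²J_ρ(x,y)/∂x² and ∂²J_ρ(x,y)/∂y², and off-diagonal entries σ·∂²J_ρ(x,y)/∂x∂y. Then for every (x,y) ∈ (0,1)²: if 0 ≤ σ ≤ ρ, the matrix M_{ρσ}(x,y) is negative semidefinite, and if ρ ≤ σ ≤ 0, the matrix M_{ρσ}(x,y) is positive semidefinite. -/

import Mathlib

open MeasureTheory

noncomputable section
namespace DMN

/-- The standard normal CDF `Φ`. -/
def Phi (t : ℝ) : ℝ := ∫ s in Set.Iic t, Real.exp (-s ^ 2 / 2) / Real.sqrt (2 * Real.pi)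

/-- The inverse of the standard normal CDF. -/
def PhiInv : ℝ → ℝ := Function.invFun Phi

/-- `J_ρ(x,y) = P[X ≤ Φ⁻¹(x), Y ≤ Φ⁻¹(y)]` for a centered bivariate Gaussian `(X,Y)`
with unit variances and covariance `ρ`, extended continuously to the boundary of
`[0,1]²`. -/
def J (ρ x y : ℝ) : ℝ :=
  if x = 0 ∨ y = 0 then 0
  else if x = 1 then y
  else if y = 1 then x
  else
    ∫ s in Set.Iic (PhiInv x), ∫ t in Set.Iic (PhiInv y),
      Real.exp (-(s ^ 2 - 2 * ρ * s * t + t ^ 2) / (2 * (1 - ρ ^ 2))) /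
        (2 * Real.pi * Real.sqrt (1 - ρ ^ 2))

/-- Partial derivative in the first variable. -/
def pdx (F : ℝ → ℝ → ℝ) : ℝ → ℝ → ℝ := fun x y => deriv (fun x' => F x' y) x

/-- Partial derivative in the second variable. -/
def pdy (F : ℝ → ℝ → ℝ) : ℝ → ℝ → ℝ := fun x y => deriv (fun y' => F x y') y

/-- The matrix `M_{ρσ}(x,y)` with diagonal entries `∂²J_ρ/∂x²`, `∂²J_ρ/∂y²` and
off-diagonal entries `σ · ∂²J_ρ/∂x∂y`. -/
def Mmat (ρ σ x y : ℝ) : Matrix (Fin 2) (Fin 2) ℝ :=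
  !![pdx (pdx (J ρ)) x y, σ * pdx (pdy (J ρ)) x y;
     σ * pdx (pdy (J ρ)) x y, pdy (pdy (J ρ)) x y]

open Set Filter Topology

/-- The standard normal density. -/
def stdNormalDensity (s : ℝ) : ℝ := Real.exp (-s ^ 2 / 2) / Real.sqrt (2 * Real.pi)

/-- The density of a centered bivariate Gaussian with unit variances and covariance `ρ`. -/
def bivariateDensity (ρ s t : ℝ) : ℝ :=
  Real.exp (-(s ^ 2 - 2 * ρ * s * t + t ^ 2) / (2 * (1 - ρ ^ 2))) /
    (2 * Real.pi * Real.sqrt (1 - ρ ^ 2))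

lemma stdNormalDensity_pos (s : ℝ) : 0 < stdNormalDensity s := by
  unfold stdNormalDensity
  positivity

lemma continuous_stdNormalDensity : Continuous stdNormalDensity := by
  unfold stdNormalDensity
  fun_prop

lemma stdNormalDensity_eq_gaussianPDFReal :
    stdNormalDensity = ProbabilityTheory.gaussianPDFReal 0 1 := by
  ext s
  simp [stdNormalDensity, ProbabilityTheory.gaussianPDFReal, div_eq_inv_mul]

lemma integrable_stdNormalDensity : Integrable stdNormalDensity := by
  rw [stdNormalDensity_eq_gaussianPDFReal]
  exact ProbabilityTheory.integrable_gaussianPDFReal 0 1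

/-- The fundamental theorem of calculus on a half-line. -/
lemma hasStrictDerivAt_integral_Iic {f : ℝ → ℝ} (hf : Integrable f) (hc : Continuous f) (a : ℝ) :
    HasStrictDerivAt (fun t => ∫ s in Iic t, f s) (f a) a := by
  have h : (fun t => ∫ s in Iic t, f s) = fun t => (∫ s in Iic a, f s) + ∫ s in a..t, f s := by
    ext t
    rw [← intervalIntegral.integral_Iic_sub_Iic hf.integrableOn hf.integrableOn]
    ring
  rw [h]
  exact (intervalIntegral.integral_hasStrictDerivAt_right hf.intervalIntegrable
    (hc.stronglyMeasurableAtFilter _ _) hc.continuousAt).const_add _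

lemma hasStrictDerivAt_Phi (a : ℝ) : HasStrictDerivAt Phi (stdNormalDensity a) a :=
  hasStrictDerivAt_integral_Iic integrable_stdNormalDensity continuous_stdNormalDensity a

lemma hasDerivAt_Phi (a : ℝ) : HasDerivAt Phi (stdNormalDensity a) a :=
  (hasStrictDerivAt_Phi a).hasDerivAt

lemma continuous_Phi : Continuous Phi :=
  continuous_iff_continuousAt.2 fun a => (hasDerivAt_Phi a).continuousAt

lemma strictMono_Phi : StrictMono Phi :=
  strictMono_of_hasDerivAt_pos hasDerivAt_Phi stdNormalDensity_pos

lemma Phi_eq_cdf : Phi = ProbabilityTheory.cdf (ProbabilityTheory.gaussianReal 0 1) := by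
  ext t
  rw [ProbabilityTheory.cdf_eq_real, measureReal_def,
    ProbabilityTheory.gaussianReal_apply_eq_integral 0 one_ne_zero, ENNReal.toReal_ofReal
      (integral_nonneg (ProbabilityTheory.gaussianPDFReal_nonneg _ _)),
    ← stdNormalDensity_eq_gaussianPDFReal]
  rfl

lemma mem_range_Phi {x : ℝ} (hx : x ∈ Ioo (0 : ℝ) 1) : x ∈ range Phi := by
  have h0 : Tendsto Phi atBot (𝓝 0) := Phi_eq_cdf ▸ ProbabilityTheory.tendsto_cdf_atBot _
  have h1 : Tendsto Phi atTop (𝓝 1) := Phi_eq_cdf ▸ ProbabilityTheory.tendsto_cdf_atTop _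
  refine mem_range_of_exists_le_of_exists_ge continuous_Phi ?_ ?_
  · exact ((h0.eventually_lt_const hx.1).exists).imp fun _ => le_of_lt
  · exact ((h1.eventually_const_lt hx.2).exists).imp fun _ => le_of_lt

lemma Phi_PhiInv {x : ℝ} (hx : x ∈ Ioo (0 : ℝ) 1) : Phi (PhiInv x) = x :=
  Function.invFun_eq (mem_range_Phi hx)

lemma hasDerivAt_PhiInv {x : ℝ} (hx : x ∈ Ioo (0 : ℝ) 1) :
    HasDerivAt PhiInv (stdNormalDensity (PhiInv x))⁻¹ x := by
  have h := ((hasStrictDerivAt_Phi (PhiInv x)).to_local_left_inverse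
    (stdNormalDensity_pos _).ne' (g := PhiInv)
    (.of_forall (Function.leftInverse_invFun strictMono_Phi.injective))).hasDerivAt
  rwa [Phi_PhiInv hx] at h

section Bivariate

variable {ρ : ℝ}

lemma bivariateDensity_comm (ρ s t : ℝ) : bivariateDensity ρ s t = bivariateDensity ρ t s := by
  unfold bivariateDensity
  ring_nf

lemma bivariateDensity_eq (hρ : 0 < 1 - ρ ^ 2) (s t : ℝ) :
    bivariateDensity ρ s t = stdNormalDensity s *
      (stdNormalDensity ((t - ρ * s) / Real.sqrt (1 - ρ ^ 2)) / Real.sqrt (1 - ρ ^ 2)) := by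
  unfold bivariateDensity stdNormalDensity
  have hpi : 2 * Real.pi * Real.sqrt (1 - ρ ^ 2) =
      Real.sqrt (2 * Real.pi) * Real.sqrt (2 * Real.pi) * Real.sqrt (1 - ρ ^ 2) := by
    rw [Real.mul_self_sqrt (by positivity)]
  have hexp : -(s ^ 2 - 2 * ρ * s * t + t ^ 2) / (2 * (1 - ρ ^ 2)) =
      -s ^ 2 / 2 + -((t - ρ * s) / Real.sqrt (1 - ρ ^ 2)) ^ 2 / 2 := by
    rw [div_pow, Real.sq_sqrt hρ.le]
    field_simp
    ring
  rw [hexp, Real.exp_add, hpi]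
  ring

lemma integrable_bivariateDensity (hρ : 0 < 1 - ρ ^ 2) :
    Integrable (Function.uncurry (bivariateDensity ρ)) (volume.prod volume) := by
  have hg : Integrable (fun s : ℝ => Real.exp (-(1 / 4) * s ^ 2)) :=
    integrable_exp_neg_mul_sq (by norm_num)
  refine ((hg.mul_prod hg).div_const (2 * Real.pi * Real.sqrt (1 - ρ ^ 2))).mono' ?_ ?_
  · refine Continuous.aestronglyMeasurable ?_
    unfold Function.uncurry bivariateDensity
    fun_prop
  · refine .of_forall fun ⟨s, t⟩ => ?_
    simp only [Function.uncurry, bivariateDensity]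
    rw [Real.norm_of_nonneg (by positivity), ← Real.exp_add]
    gcongr
    rw [div_le_iff₀ (by positivity)]
    nlinarith [sq_nonneg (s - ρ * t), sq_nonneg (t - ρ * s)]

lemma integral_Iic_stdNormalDensity_affine {r : ℝ} (hr : 0 < r) (m b : ℝ) :
    ∫ t in Iic b, stdNormalDensity ((t - m) / r) / r = Phi ((b - m) / r) := by
  have h : ∀ t, (Iic b).indicator (fun t => stdNormalDensity ((t - m) / r) / r) t =
      (fun t => (Iic ((b - m) / r)).indicator stdNormalDensity (t / r) / r) (t - m) := by
    intro t
    have : t ∈ Iic b ↔ (t - m) / r ∈ Iic ((b - m) / r) := by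
      simp [div_le_div_iff_of_pos_right hr]
    by_cases ht : t ∈ Iic b
    · simp only [indicator_of_mem ht, indicator_of_mem (this.1 ht)]
    · simp only [indicator_of_notMem ht, indicator_of_notMem (mt this.2 ht), zero_div]
  rw [← integral_indicator measurableSet_Iic, integral_congr_ae (.of_forall h),
    integral_sub_right_eq_self (fun t => (Iic ((b - m) / r)).indicator stdNormalDensity (t / r) / r),
    integral_div, Measure.integral_comp_div, integral_indicator measurableSet_Iic, smul_eq_mul,
    abs_of_pos hr, mul_div_cancel_left₀ _ hr.ne']
  rfl

lemma integral_Iic_bivariateDensity (hρ : 0 < 1 - ρ ^ 2) (s b : ℝ) :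
    ∫ t in Iic b, bivariateDensity ρ s t =
      stdNormalDensity s * Phi ((b - ρ * s) / Real.sqrt (1 - ρ ^ 2)) := by
  simp_rw [bivariateDensity_eq hρ, integral_const_mul,
    integral_Iic_stdNormalDensity_affine (Real.sqrt_pos.2 hρ)]

lemma hasDerivAt_integral_bivariateDensity (hρ : 0 < 1 - ρ ^ 2) (a b : ℝ) :
    HasDerivAt (fun a => ∫ s in Iic a, ∫ t in Iic b, bivariateDensity ρ s t)
      (stdNormalDensity a * Phi ((b - ρ * a) / Real.sqrt (1 - ρ ^ 2))) a := by
  have hint : Integrable (fun s => ∫ t in Iic b, bivariateDensity ρ s t) := by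
    have h : Integrable (Function.uncurry (bivariateDensity ρ))
        (volume.prod (volume.restrict (Iic b))) :=
      (integrable_bivariateDensity hρ).mono_measure
        (Measure.prod_mono le_rfl Measure.restrict_le_self)
    exact h.integral_prod_left
  simp_rw [integral_Iic_bivariateDensity hρ] at hint ⊢
  refine (hasStrictDerivAt_integral_Iic hint ?_ a).hasDerivAt
  exact continuous_stdNormalDensity.mul (continuous_Phi.comp (by fun_prop))

lemma J_eq {x y : ℝ} (hx : x ∈ Ioo (0 : ℝ) 1) (hy : y ∈ Ioo (0 : ℝ) 1) :
    J ρ x y = ∫ s in Iic (PhiInv x), ∫ t in Iic (PhiInv y), bivariateDensity ρ s t := by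
  simp [J, hx.1.ne', hy.1.ne', hx.2.ne, hy.2.ne, bivariateDensity]

lemma J_comm (hρ : 0 < 1 - ρ ^ 2) {x y : ℝ} (hx : x ∈ Ioo (0 : ℝ) 1)
    (hy : y ∈ Ioo (0 : ℝ) 1) : J ρ x y = J ρ y x := by
  rw [J_eq hx hy, J_eq hy hx, integral_integral_swap]
  · simp_rw [bivariateDensity_comm ρ]
  · exact (integrable_bivariateDensity hρ).mono_measure
      (Measure.prod_mono Measure.restrict_le_self Measure.restrict_le_self)

lemma pdx_J (hρ : 0 < 1 - ρ ^ 2) {x y : ℝ} (hx : x ∈ Ioo (0 : ℝ) 1)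
    (hy : y ∈ Ioo (0 : ℝ) 1) :
    pdx (J ρ) x y = Phi ((PhiInv y - ρ * PhiInv x) / Real.sqrt (1 - ρ ^ 2)) := by
  have h := (hasDerivAt_integral_bivariateDensity hρ (PhiInv x) (PhiInv y)).comp x
    (hasDerivAt_PhiInv hx)
  rw [mul_right_comm, mul_inv_cancel₀ (stdNormalDensity_pos _).ne', one_mul] at h
  refine (h.congr_of_eventuallyEq ?_).deriv
  filter_upwards [isOpen_Ioo.mem_nhds hx] with x' hx'
  exact J_eq hx' hy

lemma pdy_J (hρ : 0 < 1 - ρ ^ 2) {x y : ℝ} (hx : x ∈ Ioo (0 : ℝ) 1)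
    (hy : y ∈ Ioo (0 : ℝ) 1) :
    pdy (J ρ) x y = Phi ((PhiInv x - ρ * PhiInv y) / Real.sqrt (1 - ρ ^ 2)) := by
  rw [← pdx_J hρ hy hx]
  refine EventuallyEq.deriv_eq ?_
  filter_upwards [isOpen_Ioo.mem_nhds hy] with y' hy'
  exact J_comm hρ hx hy'

lemma deriv_Phi_comp_PhiInv {f : ℝ → ℝ} (c d r : ℝ) {x : ℝ} (hx : x ∈ Ioo (0 : ℝ) 1)
    (hf : ∀ x ∈ Ioo (0 : ℝ) 1, f x = Phi ((c + d * PhiInv x) / r)) :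
    deriv f x = d * stdNormalDensity ((c + d * PhiInv x) / r) /
      (r * stdNormalDensity (PhiInv x)) := by
  have h := (hasDerivAt_Phi ((c + d * PhiInv x) / r)).comp x
    ((((hasDerivAt_PhiInv hx).const_mul d).const_add c).div_const r)
  have heq : f =ᶠ[𝓝 x] Phi ∘ fun x => (c + d * PhiInv x) / r := by
    filter_upwards [isOpen_Ioo.mem_nhds hx] with x' hx'
    exact hf x' hx'
  rw [(h.congr_of_eventuallyEq heq).deriv]
  field_simp

lemma Mmat_eq (hρ : 0 < 1 - ρ ^ 2) {x y : ℝ} (hx : x ∈ Ioo (0 : ℝ) 1)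
    (hy : y ∈ Ioo (0 : ℝ) 1) (σ : ℝ) :
    ∃ D > 0, ∃ w, Mmat ρ σ x y = !![-ρ * D, σ * (D * w); σ * (D * w), -ρ * (D * w ^ 2)] := by
  set r := Real.sqrt (1 - ρ ^ 2) with hr
  have hr0 : 0 < r := Real.sqrt_pos.2 hρ
  set a := PhiInv x
  set b := PhiInv y with hb
  have ha0 := stdNormalDensity_pos a
  have hb0 := stdNormalDensity_pos b
  have hu0 := stdNormalDensity_pos ((b - ρ * a) / r)
  have hxx : pdx (pdx (J ρ)) x y =
      -ρ * stdNormalDensity ((b + -ρ * a) / r) / (r * stdNormalDensity a) :=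
    deriv_Phi_comp_PhiInv b (-ρ) r hx fun x' hx' => by
      rw [pdx_J hρ hx' hy, neg_mul, ← sub_eq_add_neg]
  have hyy : pdy (pdy (J ρ)) x y =
      -ρ * stdNormalDensity ((a + -ρ * b) / r) / (r * stdNormalDensity b) :=
    deriv_Phi_comp_PhiInv a (-ρ) r hy fun y' hy' => by
      rw [pdy_J hρ hx hy', neg_mul, ← sub_eq_add_neg]
  have hxy : pdx (pdy (J ρ)) x y =
      1 * stdNormalDensity ((-ρ * b + 1 * a) / r) / (r * stdNormalDensity a) :=
    deriv_Phi_comp_PhiInv (-ρ * b) 1 r hx fun x' hx' => by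
      rw [pdy_J hρ hx' hy, ← hr, ← hb]
      ring_nf
  have hsymm : stdNormalDensity ((a - ρ * b) / r) =
      stdNormalDensity a * stdNormalDensity ((b - ρ * a) / r) / stdNormalDensity b := by
    have h := bivariateDensity_comm ρ a b
    rw [bivariateDensity_eq hρ, bivariateDensity_eq hρ, ← hr] at h
    field_simp at h ⊢
    linarith
  rw [show b + -ρ * a = b - ρ * a by ring] at hxx
  rw [show a + -ρ * b = a - ρ * b by ring, hsymm] at hyy
  rw [show -ρ * b + 1 * a = a - ρ * b by ring, hsymm] at hxy
  refine ⟨stdNormalDensity ((b - ρ * a) / r) / (r * stdNormalDensity a), by positivity,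
    stdNormalDensity a / stdNormalDensity b, ?_⟩
  rw [Mmat, hxx, hyy, hxy]
  congr! 3 <;> field_simp

end Bivariate

lemma posSemidef_of_abs_le {κ τ D w : ℝ} (hκ : |τ| ≤ κ) (hD : 0 ≤ D) :
    (!![κ * D, τ * (D * w); τ * (D * w), κ * (D * w ^ 2)]).PosSemidef := by
  refine .of_dotProduct_mulVec_nonneg ?_ fun v => ?_
  · ext i j
    fin_cases i <;> fin_cases j <;> simp
  · obtain ⟨h1, h2⟩ := abs_le.1 hκ
    have hq : 0 ≤ D * ((κ + τ) * (v 0 + w * v 1) ^ 2 + (κ - τ) * (v 0 - w * v 1) ^ 2) / 2 := by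
      have h3 : 0 ≤ κ + τ := by linarith
      have h4 : 0 ≤ κ - τ := by linarith
      positivity
    simp only [Matrix.mulVec, dotProduct, Fin.sum_univ_two, Pi.star_apply, star_trivial,
      Matrix.of_apply, Matrix.cons_val_zero, Matrix.cons_val_one, Matrix.cons_val',
      Matrix.cons_val_fin_one]
    linarith

/-- **Claim 3.4**: semidefiniteness of `M_{ρσ}(x,y)`. -/
theorem Mmat_semidef (ρ : ℝ) (hρ0 : -1 < ρ) (hρ1 : ρ < 1) (x y : ℝ)
    (hx : x ∈ Set.Ioo (0 : ℝ) 1) (hy : y ∈ Set.Ioo (0 : ℝ) 1) (σ : ℝ) :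
    (0 ≤ σ → σ ≤ ρ → (-(Mmat ρ σ x y)).PosSemidef) ∧
    (ρ ≤ σ → σ ≤ 0 → (Mmat ρ σ x y).PosSemidef) := by
  obtain ⟨D, hD, w, hM⟩ := Mmat_eq (by nlinarith : 0 < 1 - ρ ^ 2) hx hy σ
  rw [hM]
  refine ⟨fun h0 h1 => ?_, fun h0 h1 => ?_⟩
  · convert posSemidef_of_abs_le (κ := ρ) (τ := -σ) (w := w) (abs_le.2 ⟨?_, ?_⟩) hD.le using 1
    · simp
    · linarith
    · linarith
  · exact posSemidef_of_abs_le (abs_le.2 ⟨by linarith, by linarith⟩) hD.le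

end DMN
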